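/- Let G be a connected compact metric graph with exponents p̄ and nonlinearities γ_e as above. Let g = (g_e) with g_e ∈ L^∞(0,ℓ_e) for every edge e. For each n ∈ ℕ let vⁿ = (vⁿ_e) be the unique family for which there exists uⁿ ∈ W^{1,p̄}(G) with vⁿ_e = γ_e ∘ uⁿ_e a.e. on (0,ℓ_e) for every e and Σ_{e∈E} ∫₀^{ℓ_e} ρ_{p_e}((uⁿ_e)') φ_e' = n Σ_{e∈E} ∫₀^{ℓ_e} (g_e − vⁿ_e) φ_e for every φ ∈ W^{1,p̄}(G) (i.e. vⁿ is the weak solution of (P_0^{vⁿ + n(g − vⁿ)})). Then Σ_{e∈E} ∫₀^{ℓ_e} |vⁿ_e − g_e| → 0 as n → ∞. Consequently, for every g with g_e ∈ L^1(0,ℓ_e) and every δ > 0 there exist w = (w_e) with w_e ∈ L^1(0,ℓ_e) and a weak solution v of (P_0^{v+w}) such that Σ_{e∈E} ∫₀^{ℓ_e} |v_e − g_e| < δ (density of the domain of the operator). -/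

import Mathlib

open MeasureTheory Set Filter

noncomputable section

/-- A connected compact metric graph: finite nonempty vertex set, finite edge set,
initial/terminal vertex maps without loops, positive edge lengths, no multiple edges,
and connectedness via paths of edges. -/
structure MetricGraph where
  V : Type
  E : Type
  fintypeV : Fintype V
  fintypeE : Fintype E
  nonemptyV : Nonempty V
  ι : E → V
  τ : E → V
  no_loops : ∀ e, ι e ≠ τ e
  len : E → ℝ
  len_pos : ∀ e, 0 < len e
  no_multi : ∀ e e', ({ι e, τ e} : Set V) = ({ι e', τ e'} : Set V) → e = e'
  connected : ∀ v w : V,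
    Relation.ReflTransGen (fun a b => ∃ e, (ι e = a ∧ τ e = b) ∨ (ι e = b ∧ τ e = a)) v w

/-- Sum over the edges of the graph. -/
def edgeSum (G : MetricGraph) (F : G.E → ℝ) : ℝ :=
  letI := G.fintypeE
  ∑ e, F e

/-- Sum over the vertices of the graph. -/
def vertexSum (G : MetricGraph) (F : G.V → ℝ) : ℝ :=
  letI := G.fintypeV
  ∑ v, F v

/-- Number of vertices. -/
def vertexCard (G : MetricGraph) : ℕ :=
  letI := G.fintypeV
  Fintype.card G.V

/-- ρ_p(r) = |r|^(p-2) r. -/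
def rho (p r : ℝ) : ℝ := |r| ^ (p - 2) * r

/-- `(u, u')` is in the Sobolev space W^{1,p}(0,ℓ): `u'` is integrable with `|u'|^p`
integrable on (0,ℓ), and `u` is absolutely continuous on [0,ℓ] with derivative `u'`. -/
def IntervalSobolev (ℓ p : ℝ) (u u' : ℝ → ℝ) : Prop :=
  IntegrableOn u' (Ioo 0 ℓ) volume ∧
  IntegrableOn (fun x => |u' x| ^ p) (Ioo 0 ℓ) volume ∧
  ∀ x ∈ Icc (0:ℝ) ℓ, u x = u 0 + ∫ t in (0:ℝ)..x, u' t

/-- `(u, u')` is in W^{1,p̄}(G), continuous at the vertices with vertex values `uV`. -/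
def GraphSobolev (G : MetricGraph) (p : G.E → ℝ) (u u' : G.E → ℝ → ℝ) (uV : G.V → ℝ) : Prop :=
  (∀ e, IntervalSobolev (G.len e) (p e) (u e) (u' e)) ∧
  (∀ e, u e 0 = uV (G.ι e)) ∧
  (∀ e, u e (G.len e) = uV (G.τ e))

/-- `v` is a weak solution of the graph problem (P_ω^f) with data `u, u', uV`. -/
def SolvesGraphProblem (G : MetricGraph) (p : G.E → ℝ) (γ : G.E → ℝ → ℝ)
    (f : G.E → ℝ → ℝ) (ω : G.V → ℝ)
    (v : G.E → ℝ → ℝ) (u u' : G.E → ℝ → ℝ) (uV : G.V → ℝ) : Prop :=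
  (∀ e, IntegrableOn (v e) (Ioo 0 (G.len e)) volume) ∧
  GraphSobolev G p u u' uV ∧
  (∀ e, ∀ᵐ x ∂(volume.restrict (Ioo 0 (G.len e))), v e x = γ e (u e x)) ∧
  ∀ φ φ' : G.E → ℝ → ℝ, ∀ φV : G.V → ℝ, GraphSobolev G p φ φ' φV →
    edgeSum G (fun e => ∫ x in Ioo 0 (G.len e), v e x * φ e x)
      + edgeSum G (fun e => ∫ x in Ioo 0 (G.len e), rho (p e) (u' e x) * φ' e x)
    = edgeSum G (fun e => ∫ x in Ioo 0 (G.len e), f e x * φ e x)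
      + vertexSum G (fun w => ω w * φV w)

/-- `v` is a weak solution of the graph problem (P_ω^f). -/
def IsGraphWeakSolution (G : MetricGraph) (p : G.E → ℝ) (γ : G.E → ℝ → ℝ)
    (f : G.E → ℝ → ℝ) (ω : G.V → ℝ) (v : G.E → ℝ → ℝ) : Prop :=
  ∃ u u' uV, SolvesGraphProblem G p γ f ω v u u' uV

/-- `v` is a weak solution of the interval Neumann problem (P^{γ,f}_{p,a,b}),
with associated Sobolev function `u` (derivative `u'`). -/
def SolvesNeumann (ℓ p : ℝ) (γ f : ℝ → ℝ) (a b : ℝ) (v u u' : ℝ → ℝ) : Prop :=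
  IntegrableOn v (Ioo 0 ℓ) volume ∧
  IntervalSobolev ℓ p u u' ∧
  (∀ᵐ x ∂(volume.restrict (Ioo 0 ℓ)), v x = γ (u x)) ∧
  ∀ φ φ' : ℝ → ℝ, IntervalSobolev ℓ p φ φ' →
    (∫ x in Ioo 0 ℓ, v x * φ x) + (∫ x in Ioo 0 ℓ, rho p (u' x) * φ' x)
    = (∫ x in Ioo 0 ℓ, f x * φ x) + a * φ 0 + b * φ ℓ

/-- `v` is a weak solution of the interval Neumann problem (P^{γ,f}_{p,a,b}). -/
def IsNeumannWeakSolution (ℓ p : ℝ) (γ f : ℝ → ℝ) (a b : ℝ) (v : ℝ → ℝ) : Prop :=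
  ∃ u u', SolvesNeumann ℓ p γ f a b v u u'

end

lemma rho_eq {q : ℝ} (hq : 1 < q) (r : ℝ) :
    rho q r = (max r 0) ^ (q - 1) - (max (-r) 0) ^ (q - 1) := by
  have h0 : (0:ℝ) ^ (q - 1) = 0 := Real.zero_rpow (by linarith)
  have key : ∀ s : ℝ, 0 < s → s ^ (q - 2) * s = s ^ (q - 1) := fun s hs => by
    rw [← Real.rpow_add_one hs.ne']; congr 1; ring
  rcases lt_trichotomy r 0 with h | h | h
  · rw [rho, max_eq_right h.le, max_eq_left (by linarith : (0:ℝ) ≤ -r), abs_of_neg h, h0,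
      ← key (-r) (by linarith)]
    ring
  · simp [rho, h, h0]
  · rw [rho, max_eq_left h.le, max_eq_right (by linarith : -r ≤ (0:ℝ)), abs_of_pos h, h0, key r h,
      sub_zero]

lemma continuous_rho {q : ℝ} (hq : 1 < q) : Continuous (rho q) := by
  have h : rho q = fun r => (max r 0) ^ (q - 1) - (max (-r) 0) ^ (q - 1) := funext (rho_eq hq)
  have hq' : 0 ≤ q - 1 := by linarith
  rw [h]
  exact ((continuous_id.max continuous_const).rpow_const fun _ => Or.inr hq').sub
    ((continuous_neg.max continuous_const).rpow_const fun _ => Or.inr hq')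

lemma monotone_rho {q : ℝ} (hq : 1 < q) : Monotone (rho q) := by
  intro a b hab
  have hq' : 0 ≤ q - 1 := by linarith
  rw [rho_eq hq, rho_eq hq]
  have h₁ : (max a 0) ^ (q - 1) ≤ (max b 0) ^ (q - 1) :=
    Real.rpow_le_rpow (le_max_right _ _) (max_le_max_right _ hab) hq'
  have h₂ : (max (-b) 0) ^ (q - 1) ≤ (max (-a) 0) ^ (q - 1) :=
    Real.rpow_le_rpow (le_max_right _ _) (max_le_max_right _ (neg_le_neg hab)) hq'
  linarith

lemma abs_rho {p r : ℝ} (hr : r ≠ 0) : |rho p r| = |r| ^ (p - 1) := by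
  rw [rho, abs_mul, abs_of_nonneg (by positivity : 0 ≤ |r| ^ (p - 2)),
    ← Real.rpow_add_one (abs_pos.2 hr).ne']
  congr 1; ring

/-- `rho q` inverts `rho p` for conjugate exponents. -/
lemma rho_rho {p q : ℝ} (hpq : (p - 1) * (q - 1) = 1) (r : ℝ) : rho q (rho p r) = r := by
  rcases eq_or_ne r 0 with rfl | hr
  · simp [rho]
  have hr' : 0 < |r| := abs_pos.2 hr
  rw [rho, abs_rho hr, rho, ← Real.rpow_mul hr'.le, ← mul_assoc, ← Real.rpow_add hr',
    show (p - 1) * (q - 2) + (p - 2) = 0 by linear_combination hpq, Real.rpow_zero, one_mul]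

lemma neg_rpow_le_rho_mul_sub {p : ℝ} (hp : 1 < p) (a k : ℝ) :
    -(|k| ^ p) ≤ rho p a * (a - k) := by
  have hk0 : 0 ≤ |k| ^ p := by positivity
  rcases eq_or_ne a 0 with rfl | ha
  · simp [rho, hk0]
  have haa : rho p a * a = |rho p a| * |a| := by
    rw [← abs_mul, abs_of_nonneg]
    rw [rho, mul_assoc]
    exact mul_nonneg (by positivity) (mul_self_nonneg a)
  have hak : rho p a * k ≤ |rho p a| * |k| := by
    rw [← abs_mul]; exact le_abs_self _
  rcases le_total |k| |a| with h | h
  · have := mul_le_mul_of_nonneg_left h (abs_nonneg (rho p a))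
    linarith [mul_sub (rho p a) a k]
  · have h1 : |rho p a| * |k| ≤ |k| ^ p := by
      calc |rho p a| * |k| = |a| ^ (p - 1) * |k| := by rw [abs_rho ha]
        _ ≤ |k| ^ (p - 1) * |k| := by gcongr
        _ = |k| ^ p := by
          rw [← Real.rpow_add_one ((abs_pos.2 ha).trans_le h).ne']; congr 1; ring
    have h2 : 0 ≤ |rho p a| * |a| := by positivity
    linarith [mul_sub (rho p a) a k]

lemma IntervalSobolev.intervalIntegrable {ℓ p : ℝ} {u u' : ℝ → ℝ} (hℓ : 0 < ℓ)
    (h : IntervalSobolev ℓ p u u') : IntervalIntegrable u' volume 0 ℓ :=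
  (intervalIntegrable_iff_integrableOn_Ioo_of_le hℓ.le).2 h.1

lemma IntervalSobolev.continuousOn {ℓ p : ℝ} {u u' : ℝ → ℝ} (hℓ : 0 < ℓ)
    (h : IntervalSobolev ℓ p u u') : ContinuousOn u (Icc 0 ℓ) := by
  have h1 : ContinuousOn (fun x => u 0 + ∫ t in (0:ℝ)..x, u' t) (Icc 0 ℓ) := by
    have := (h.intervalIntegrable hℓ).absolutelyContinuousOnInterval_intervalIntegral
      (c := 0) (by simp)
    have h2 := this.continuousOn
    rw [uIcc_of_le hℓ.le] at h2
    exact continuousOn_const.add h2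
  exact h1.congr h.2.2

lemma IntervalSobolev.integrable_mul {ℓ p : ℝ} {u u' f : ℝ → ℝ} (hℓ : 0 < ℓ)
    (h : IntervalSobolev ℓ p u u') (hf : IntegrableOn f (Ioo 0 ℓ)) :
    IntegrableOn (fun x => f x * u x) (Ioo 0 ℓ) := by
  have := (((intervalIntegrable_iff_integrableOn_Ioo_of_le hℓ.le).2 hf).mul_continuousOn
    (by rw [uIcc_of_le hℓ.le]; exact h.continuousOn hℓ))
  exact (intervalIntegrable_iff_integrableOn_Ioo_of_le hℓ.le).1 this

lemma IntervalSobolev.sub {ℓ p : ℝ} {u u' k k' : ℝ → ℝ} (hℓ : 0 < ℓ) (hp : 1 < p)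
    (hu : IntervalSobolev ℓ p u u') (hk : IntervalSobolev ℓ p k k') :
    IntervalSobolev ℓ p (fun x => u x - k x) (fun x => u' x - k' x) := by
  refine ⟨hu.1.sub hk.1, ?_, fun x hx => ?_⟩
  · have h0 : ENNReal.ofReal p ≠ 0 := by simp; linarith
    have key : ∀ f : ℝ → ℝ, IntegrableOn f (Ioo 0 ℓ) →
        (IntegrableOn (fun x => |f x| ^ p) (Ioo 0 ℓ) ↔
          MemLp f (ENNReal.ofReal p) (volume.restrict (Ioo 0 ℓ))) := fun f hf => by
      rw [← integrable_norm_rpow_iff hf.1 h0 ENNReal.ofReal_ne_top,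
        ENNReal.toReal_ofReal (by linarith)]
      simp only [Real.norm_eq_abs, IntegrableOn]
    exact (key _ (hu.1.sub hk.1)).2 (((key _ hu.1).1 hu.2.1).sub ((key _ hk.1).1 hk.2.1))
  · have hsub : ∀ {f : ℝ → ℝ}, IntervalIntegrable f volume 0 ℓ →
        IntervalIntegrable f volume 0 x := fun hf => hf.mono_set (by
      rw [uIcc_of_le hx.1, uIcc_of_le hℓ.le]; exact Icc_subset_Icc_right hx.2)
    simp only
    rw [intervalIntegral.integral_sub (hsub (hu.intervalIntegrable hℓ))
      (hsub (hk.intervalIntegrable hℓ)), hu.2.2 x hx, hk.2.2 x hx]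
    ring

lemma IntervalSobolev.integral_mul_deriv {ℓ p : ℝ} {φ φ' W : ℝ → ℝ} (hℓ : 0 < ℓ)
    (hφ : IntervalSobolev ℓ p φ φ') (hW : ContDiff ℝ 1 W) (hW0 : W 0 = 0) (hWℓ : W ℓ = 0) :
    ∫ x in Ioo 0 ℓ, W x * φ' x = ∫ x in Ioo 0 ℓ, -deriv W x * φ x := by
  have hi := hφ.intervalIntegrable hℓ
  set Φ : ℝ → ℝ := fun x => ∫ t in (0:ℝ)..x, φ' t with hΦ
  have hΦac : AbsolutelyContinuousOnInterval Φ 0 ℓ :=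
    hi.absolutelyContinuousOnInterval_intervalIntegral (by simp)
  have hWac : AbsolutelyContinuousOnInterval W 0 ℓ :=
    ContDiffOn.absolutelyContinuousOnInterval hW.contDiffOn
  have hibp := hWac.integral_mul_deriv_eq_deriv_mul hΦac
  have hW' : IntervalIntegrable (deriv W) volume 0 ℓ :=
    (hW.continuous_deriv le_rfl).intervalIntegrable _ _
  have h1 : ∫ x in (0:ℝ)..ℓ, W x * deriv Φ x = ∫ x in (0:ℝ)..ℓ, W x * φ' x := by
    refine intervalIntegral.integral_congr_ae ?_
    filter_upwards [hi.ae_hasDerivAt_integral] with x hx hx'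
    rw [(hx (uIoc_subset_uIcc hx') 0 (by simp)).deriv]
  have h2 : ∫ x in (0:ℝ)..ℓ, deriv W x * φ x = ∫ x in (0:ℝ)..ℓ, deriv W x * Φ x := by
    have hFTC : ∫ x in (0:ℝ)..ℓ, deriv W x = 0 := by
      rw [hWac.integral_deriv_eq_sub, hW0, hWℓ, sub_zero]
    have : ∫ x in (0:ℝ)..ℓ, deriv W x * φ x
        = ∫ x in (0:ℝ)..ℓ, (deriv W x * φ 0 + deriv W x * Φ x) := by
      refine intervalIntegral.integral_congr fun x hx => ?_
      rw [uIcc_of_le hℓ.le] at hx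
      simp only [hφ.2.2 x hx, hΦ]
      ring
    rw [this, intervalIntegral.integral_add (hW'.mul_const _)
      (hW'.mul_continuousOn hΦac.continuousOn), intervalIntegral.integral_mul_const, hFTC]
    ring
  rw [← integral_Ioc_eq_integral_Ioo, ← integral_Ioc_eq_integral_Ioo,
    ← intervalIntegral.integral_of_le hℓ.le, ← intervalIntegral.integral_of_le hℓ.le, ← h1, hibp]
  simp only [neg_mul, intervalIntegral.integral_neg]
  rw [h2, hW0, hWℓ]
  ring

/-- A bounded function on `(0, ℓ)` is an `L¹`-limit of equally bounded continuous functions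
vanishing near both endpoints. -/
lemma exists_continuous_integral_sub_lt {ℓ M ε : ℝ} {b : ℝ → ℝ} (hM : 0 ≤ M)
    (hb : AEStronglyMeasurable b (volume.restrict (Ioo 0 ℓ)))
    (hbM : ∀ᵐ x ∂(volume.restrict (Ioo 0 ℓ)), |b x| ≤ M) (hε : 0 < ε) :
    ∃ c : ℝ → ℝ, Continuous c ∧ (∀ x, |c x| ≤ M) ∧
      (∃ m, 0 < m ∧ ∀ x, x * (ℓ - x) < m → c x = 0) ∧
      ∫ x in Ioo 0 ℓ, |c x - b x| < ε := by
  have hbi : IntegrableOn b (Ioo 0 ℓ) :=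
    Integrable.of_bound hb M (by simpa only [Real.norm_eq_abs] using hbM)
  obtain ⟨c₀, -, hc₀, hc₀c, hc₀i⟩ :=
    hbi.exists_hasCompactSupport_integral_sub_le (half_pos hε)
  set χ : ℕ → ℝ → ℝ := fun n x => max 0 (min 1 (n * (x * (ℓ - x)) - 1)) with hχ
  set c₁ : ℝ → ℝ := fun x => max (-M) (min M (c₀ x)) with hc₁
  have hc₁c : Continuous c₁ := by fun_prop
  have hχc : ∀ n, Continuous (χ n) := fun n => by fun_prop
  have hc₁M : ∀ x, |c₁ x| ≤ M := fun x =>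
    abs_le.2 ⟨le_max_left _ _, max_le (by linarith) (min_le_left _ _)⟩
  have hχ0 : ∀ n x, 0 ≤ χ n x := fun n x => le_max_left _ _
  have hχ1 : ∀ n x, χ n x ≤ 1 := fun n x => max_le zero_le_one (min_le_left _ _)
  have hcM : ∀ n x, |χ n x * c₁ x| ≤ M := fun n x => by
    rw [abs_mul, abs_of_nonneg (hχ0 n x)]
    exact (mul_le_of_le_one_left (abs_nonneg _) (hχ1 n x)).trans (hc₁M x)
  have hlim : Tendsto (fun n => ∫ x in Ioo 0 ℓ, |χ n x * c₁ x - b x|) atTop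
      (nhds (∫ x in Ioo 0 ℓ, |c₁ x - b x|)) := by
    refine tendsto_integral_of_dominated_convergence (fun _ => M + M) (fun n => ?_)
      (integrable_const _) (fun n => ?_) ?_
    · exact (((hχc n).mul hc₁c).aestronglyMeasurable.sub hb).norm
    · filter_upwards [hbM] with x hx
      rw [Real.norm_eq_abs, abs_abs]
      exact (abs_sub _ _).trans (add_le_add (hcM n x) hx)
    · filter_upwards [ae_restrict_mem measurableSet_Ioo] with x hx
      have hpos : 0 < x * (ℓ - x) := mul_pos hx.1 (sub_pos.2 hx.2)
      refine tendsto_const_nhds.congr' ?_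
      obtain ⟨N, hN⟩ := exists_nat_ge (2 / (x * (ℓ - x)))
      filter_upwards [eventually_ge_atTop N] with n hn
      have h1 : 2 ≤ n * (x * (ℓ - x)) := by
        rw [← div_le_iff₀ hpos]; exact hN.trans (by exact_mod_cast hn)
      have : χ n x = 1 := by
        simp only [hχ]; rw [min_eq_left (by linarith), max_eq_right zero_le_one]
      rw [this, one_mul]
  have hlt : ∫ x in Ioo 0 ℓ, |c₁ x - b x| < ε := by
    refine lt_of_le_of_lt (le_trans (integral_mono_of_nonneg ?_ ?_ ?_) hc₀) (half_lt_self hε)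
    · exact Eventually.of_forall fun x => abs_nonneg _
    · exact (hbi.sub hc₀i).norm
    · filter_upwards [hbM] with x hx
      rw [Real.norm_eq_abs, abs_sub_comm (b x)]
      have := abs_le.1 hx
      simp only [hc₁]
      rcases le_total (c₀ x) M with h | h
      · rw [min_eq_right h]
        rcases le_total (-M) (c₀ x) with h' | h'
        · rw [max_eq_right h']
        · rw [max_eq_left h', abs_of_nonpos (by linarith), abs_of_nonpos (by linarith)]
          linarith
      · rw [min_eq_left h, max_eq_right (by linarith), abs_of_nonneg (by linarith),
          abs_of_nonneg (by linarith)]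
        linarith
  obtain ⟨n, hn, hn0⟩ := ((hlim.eventually_lt_const hlt).and (eventually_gt_atTop 0)).exists
  have hn0' : (0:ℝ) < n := by exact_mod_cast hn0
  refine ⟨fun x => χ n x * c₁ x, (hχc n).mul hc₁c, hcM n, ⟨1 / n, by positivity, fun x hx => ?_⟩,
    hn⟩
  have h1 : n * (x * (ℓ - x)) < 1 := by rwa [lt_div_iff₀ hn0', mul_comm] at hx
  have : χ n x = 0 := by
    simp only [hχ]
    exact max_eq_left ((min_le_right _ _).trans (by linarith))
  simp only [this, zero_mul]

/-- A continuous function vanishing near both endpoints of `(0, ℓ)` is a uniform limit of functions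
`u` with `u 0 = u ℓ = 0` for which `rho p u'` is `C¹` and vanishes at both endpoints. -/
lemma exists_contDiff_rho_deriv {ℓ p m ε : ℝ} {c : ℝ → ℝ} (hℓ : 0 < ℓ) (hp : 1 < p)
    (hc : Continuous c) (hm : 0 < m) (hcm : ∀ x, x * (ℓ - x) < m → c x = 0) (hε : 0 < ε) :
    ∃ u u' W : ℝ → ℝ, Continuous u' ∧ (∀ x, u x = ∫ t in (0:ℝ)..x, u' t) ∧ u ℓ = 0 ∧
      (∀ x ∈ Icc 0 ℓ, |u x - c x| ≤ ε) ∧ ContDiff ℝ 1 W ∧ W 0 = 0 ∧ W ℓ = 0 ∧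
      ∀ x, rho p (u' x) = W x := by
  obtain ⟨q, hq, hpq⟩ : ∃ q : ℝ, 1 < q ∧ (p - 1) * (q - 1) = 1 := by
    have hp' : 0 < p - 1 := by linarith
    refine ⟨1 + (p - 1)⁻¹, by simp [hp'], ?_⟩
    field_simp
    ring
  obtain ⟨k, hk, hkc, hks⟩ := hc.exists_contDiff_approx (n := 1) (ε := fun _ => ε / 2)
    continuous_const (fun _ => half_pos hε)
  have hk0 : ∀ x, x * (ℓ - x) < m → k x = 0 := fun x hx => by
    by_contra h
    exact hks h (hcm x hx)
  have hk'c : Continuous (deriv k) := hk.continuous_deriv le_rfl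
  have hk'0 : ∀ x, x * (ℓ - x) < m → deriv k x = 0 := fun x hx => by
    have h1 : IsOpen {y : ℝ | y * (ℓ - y) < m} :=
      isOpen_lt (by fun_prop) continuous_const
    have h2 : k =ᶠ[nhds x] fun _ => 0 := by
      filter_upwards [h1.mem_nhds hx] with y hy using hk0 y hy
    rw [h2.deriv_eq, deriv_const]
  set F : ℝ → ℝ := fun x => rho p (deriv k x) with hF
  have hFc : Continuous F := (continuous_rho hp).comp hk'c
  have hF0 : ∀ x, x * (ℓ - x) < m → F x = 0 := fun x hx => by
    simp [hF, hk'0 x hx, rho]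
  have hσF : ∀ x, rho q (F x) = deriv k x := fun x => rho_rho hpq _
  obtain ⟨R, hR⟩ : ∃ R, ∀ x ∈ Icc 0 ℓ, |F x| ≤ R :=
    isCompact_Icc.exists_bound_of_continuousOn hFc.continuousOn
  have huc := isCompact_Icc.uniformContinuousOn_of_continuous
    ((continuous_rho hq).continuousOn (s := Icc (-(R + 1)) (R + 1)))
  obtain ⟨δ₀, hδ₀, hδ₀'⟩ := Metric.uniformContinuousOn_iff.1 huc (ε / (2 * ℓ)) (by positivity)
  set H : ℝ := ℓ ^ 2 / m
  have hH0 : 0 ≤ H := by positivity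
  obtain ⟨δ, hδ, hδ1, hδ2⟩ : ∃ δ > 0, δ * (1 + H) < δ₀ ∧ δ * (1 + H) ≤ 1 := by
    refine ⟨min (δ₀ / 2) 1 / (1 + H), by positivity, ?_, ?_⟩
    · rw [div_mul_cancel₀ _ (by positivity)]
      exact (min_le_left _ _).trans_lt (half_lt_self hδ₀)
    · rw [div_mul_cancel₀ _ (by positivity)]
      exact min_le_right _ _
  obtain ⟨W₀, hW₀, hW₀F, hW₀s⟩ := hFc.exists_contDiff_approx (n := 1) (ε := fun _ => δ)
    continuous_const (fun _ => hδ)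
  set η : ℝ → ℝ := fun x => x * (ℓ - x) / m with hη
  have hηd : ContDiff ℝ 1 η := by fun_prop
  have hη0 : ∀ x ∈ Icc 0 ℓ, 0 ≤ η x := fun x hx =>
    div_nonneg (mul_nonneg hx.1 (sub_nonneg.2 hx.2)) hm.le
  have hηH : ∀ x ∈ Icc 0 ℓ, η x ≤ H := fun x hx => by
    refine div_le_div_of_nonneg_right ?_ hm.le
    nlinarith [hx.1, hx.2]
  have hbound : ∀ x ∈ Icc 0 ℓ, |W₀ x - F x| ≤ δ * η x := fun x hx => by
    rcases lt_or_ge (x * (ℓ - x)) m with h | h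
    · have : W₀ x = 0 := by
        by_contra h'
        exact hW₀s h' (hF0 x h)
      rw [this, hF0 x h, sub_zero, abs_zero]
      exact mul_nonneg hδ.le (hη0 x hx)
    · have h1 : 1 ≤ η x := (one_le_div hm).2 h
      have h2 := (hW₀F x).le
      rw [Real.dist_eq] at h2
      nlinarith
  set Φ : ℝ → ℝ := fun s => ∫ x in (0:ℝ)..ℓ, rho q (W₀ x + s * η x) with hΦ
  have hW₀c := hW₀.continuous
  have hηc := hηd.continuous
  have hΦc : Continuous Φ := by
    refine intervalIntegral.continuous_parametric_intervalIntegral_of_continuous ?_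
      continuous_const
    refine (continuous_rho hq).comp ?_
    fun_prop
  have hsc : ∀ s : ℝ, Continuous fun x => rho q (W₀ x + s * η x) := fun s =>
    (continuous_rho hq).comp (by fun_prop)
  have hkint : ∀ x, ∫ t in (0:ℝ)..x, deriv k t = k x := fun x => by
    rw [intervalIntegral.integral_deriv_eq_sub
      (fun y _ => (hk.differentiable one_ne_zero).differentiableAt)
      (hk'c.intervalIntegrable _ _), hk0 0 (by simpa using hm), sub_zero]
  have hkℓ : k ℓ = 0 := hk0 ℓ (by simpa using hm)
  have hlow : Φ (-δ) ≤ 0 := by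
    rw [← hkℓ, ← hkint ℓ]
    refine intervalIntegral.integral_mono_on hℓ.le ((hsc _).intervalIntegrable _ _)
      (hk'c.intervalIntegrable _ _) fun x hx => ?_
    rw [← hσF]
    have := (abs_le.1 (hbound x hx)).2
    exact monotone_rho hq (by linarith)
  have hhigh : 0 ≤ Φ δ := by
    rw [← hkℓ, ← hkint ℓ]
    refine intervalIntegral.integral_mono_on hℓ.le (hk'c.intervalIntegrable _ _)
      ((hsc _).intervalIntegrable _ _) fun x hx => ?_
    rw [← hσF]
    have := (abs_le.1 (hbound x hx)).1
    exact monotone_rho hq (by linarith)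
  obtain ⟨s, hs, hs0⟩ : (0:ℝ) ∈ Φ '' Icc (-δ) δ :=
    intermediate_value_Icc (by linarith) hΦc.continuousOn ⟨hlow, hhigh⟩
  refine ⟨fun x => ∫ t in (0:ℝ)..x, rho q (W₀ t + s * η t), fun x => rho q (W₀ x + s * η x),
    fun x => W₀ x + s * η x, hsc s, fun _ => rfl, hs0, fun x hx => ?_,
    hW₀.add (contDiff_const.mul hηd), ?_, ?_, fun x => rho_rho (by linarith [mul_comm (p-1) (q-1)]) _⟩
  · have h1 : |(∫ t in (0:ℝ)..x, rho q (W₀ t + s * η t)) - k x| ≤ ε / 2 := by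
      rw [← hkint x, ← intervalIntegral.integral_sub ((hsc s).intervalIntegrable _ _)
        (hk'c.intervalIntegrable _ _)]
      have h2 := intervalIntegral.norm_integral_le_of_norm_le_const (a := 0) (b := x)
        (f := fun t => rho q (W₀ t + s * η t) - deriv k t) (C := ε / (2 * ℓ)) (fun t ht => by
          rw [uIoc_of_le hx.1] at ht
          have ht' : t ∈ Icc 0 ℓ := ⟨ht.1.le, ht.2.trans hx.2⟩
          rw [← hσF, ← dist_eq_norm]
          have hFR := abs_le.1 (hR t ht')
          have hd : |W₀ t + s * η t - F t| ≤ δ * (1 + H) := by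
            have e1 : |W₀ t - F t| ≤ δ := by
              rw [← Real.dist_eq]; exact (hW₀F t).le
            have e2 : |s * η t| ≤ δ * H := by
              rw [abs_mul, abs_of_nonneg (hη0 t ht')]
              exact mul_le_mul (abs_le.2 hs) (hηH t ht') (hη0 t ht') hδ.le
            calc |W₀ t + s * η t - F t| = |(W₀ t - F t) + s * η t| := by ring_nf
              _ ≤ |W₀ t - F t| + |s * η t| := abs_add_le _ _
              _ ≤ δ * (1 + H) := by linarith
          have hd' := abs_le.1 (hd.trans hδ2)
          refine (hδ₀' _ ⟨?_, ?_⟩ _ ⟨?_, ?_⟩ ?_).le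
          · linarith
          · linarith
          · linarith
          · linarith
          · rw [Real.dist_eq]
            exact hd.trans_lt hδ1)
      rw [Real.norm_eq_abs, sub_zero, abs_of_nonneg hx.1] at h2
      refine h2.trans ?_
      calc ε / (2 * ℓ) * x ≤ ε / (2 * ℓ) * ℓ := by gcongr; exact hx.2
        _ = ε / 2 := by field_simp
    have h3 := (hkc x).le
    rw [Real.dist_eq] at h3
    have := abs_sub_le (∫ t in (0:ℝ)..x, rho q (W₀ t + s * η t)) (k x) (c x)
    linarith
  · have : W₀ 0 = 0 := by
      by_contra h'
      exact hW₀s h' (hF0 0 (by simpa using hm))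
    simp [this, hη]
  · have : W₀ ℓ = 0 := by
      by_contra h'
      exact hW₀s h' (hF0 ℓ (by simpa using hm))
    simp [this, hη]

/-- A bounded function on `(0, ℓ)` is an `L¹`-limit of uniformly bounded Sobolev functions vanishing at
both endpoints whose `p`-Laplacian is a continuous function. -/
lemma exists_intervalSobolev_approx {ℓ p M ε : ℝ} {b : ℝ → ℝ} (hℓ : 0 < ℓ) (hp : 1 < p)
    (hM : 0 ≤ M) (hb : AEStronglyMeasurable b (volume.restrict (Ioo 0 ℓ)))
    (hbM : ∀ᵐ x ∂(volume.restrict (Ioo 0 ℓ)), |b x| ≤ M) (hε : 0 < ε) :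
    ∃ u u' w : ℝ → ℝ, IntervalSobolev ℓ p u u' ∧ Continuous u ∧ u 0 = 0 ∧ u ℓ = 0 ∧
      (∀ x ∈ Icc 0 ℓ, |u x| ≤ M + 1) ∧ (∫ x in Ioo 0 ℓ, |u x - b x| < ε) ∧ Continuous w ∧
      ∀ φ φ', IntervalSobolev ℓ p φ φ' →
        ∫ x in Ioo 0 ℓ, rho p (u' x) * φ' x = ∫ x in Ioo 0 ℓ, w x * φ x := by
  obtain ⟨c, hc, hcM, ⟨m, hm, hcm⟩, hcb⟩ :=
    exists_continuous_integral_sub_lt hM hb hbM (half_pos hε)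
  obtain ⟨u, u', W, hu', hu, huℓ, huc, hW, hW0, hWℓ, hρ⟩ :=
    exists_contDiff_rho_deriv (p := p) (ε := min 1 (ε / (2 * ℓ))) hℓ hp hc hm hcm
      (by positivity)
  have hucont : Continuous u := by
    rw [funext hu]
    exact intervalIntegral.continuous_primitive (fun a b => hu'.intervalIntegrable a b) 0
  have hu0 : u 0 = 0 := by rw [hu, intervalIntegral.integral_same]
  have hint : ∀ {f : ℝ → ℝ}, Continuous f → IntegrableOn f (Ioo 0 ℓ) := fun hf =>
    (hf.continuousOn.integrableOn_Icc).mono_set Ioo_subset_Icc_self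
  have hbi : IntegrableOn b (Ioo 0 ℓ) :=
    Integrable.of_bound hb M (by simpa only [Real.norm_eq_abs] using hbM)
  refine ⟨u, u', fun x => -deriv W x, ⟨hint hu', hint ?_, fun x _ => ?_⟩, hucont, hu0, huℓ,
    fun x hx => ?_, ?_, (hW.continuous_deriv le_rfl).neg, fun φ φ' hφ => ?_⟩
  · exact hu'.abs.rpow_const fun _ => Or.inr (by linarith)
  · rw [hu0, zero_add, hu]
  · have h1 := (huc x hx).trans (min_le_left _ _)
    have h2 := abs_sub_abs_le_abs_sub (u x) (c x)
    linarith [hcM x]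
  · have h1 : ∫ x in Ioo 0 ℓ, |u x - c x| ≤ ε / 2 := by
      have h2 : ∫ x in Ioo 0 ℓ, |u x - c x| ≤ ∫ x in Ioo 0 ℓ, ε / (2 * ℓ) := by
        refine setIntegral_mono_on (hint (hucont.sub hc).abs) (hint continuous_const)
          measurableSet_Ioo fun x hx => ?_
        exact (huc x (Ioo_subset_Icc_self hx)).trans (min_le_right _ _)
      refine h2.trans (le_of_eq ?_)
      simp [hℓ.le]
      field_simp
    have h3 : ∫ x in Ioo 0 ℓ, |u x - b x| ≤
        ∫ x in Ioo 0 ℓ, (|u x - c x| + |c x - b x|) :=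
      setIntegral_mono_on ((hint hucont).sub hbi).abs
        ((hint (hucont.sub hc).abs).add ((hint hc).sub hbi).abs) measurableSet_Ioo
        fun x _ => abs_sub_le _ _ _
    have h4 := integral_add (μ := volume.restrict (Ioo 0 ℓ)) (f := fun x => |u x - c x|)
      (g := fun x => |c x - b x|) (hint (hucont.sub hc).abs) ((hint hc).sub hbi).abs
    linarith
  · simp only [hρ]
    exact hφ.integral_mul_deriv hℓ hW hW0 hWℓ

lemma Monotone.abs_sub_mul_abs_sub {γ : ℝ → ℝ} (hγ : Monotone γ) (a b : ℝ) :
    |γ a - γ b| * |a - b| = (γ a - γ b) * (a - b) := by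
  rw [← abs_mul, abs_of_nonneg]
  rcases le_total a b with h | h
  · exact mul_nonneg_of_nonpos_of_nonpos (sub_nonpos.2 (hγ h)) (sub_nonpos.2 h)
  · exact mul_nonneg (sub_nonneg.2 (hγ h)) (sub_nonneg.2 h)

/-- The cost of replacing `b` by a nearby bounded value `k` in `(γ a - γ b) * (a - b)`, uniformly in
the unbounded variable `a`. -/
lemma exists_half_mul_sub_le {γ : ℝ → ℝ} (hc : Continuous γ) (hγ : Monotone γ) {M : ℝ}
    (hM : 0 ≤ M) :
    ∃ D, 0 ≤ D ∧ ∀ a b k, |b| ≤ M → |k| ≤ M →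
      (γ a - γ b) * (a - b) / 2 ≤ (γ a - γ b) * (a - k) + D * |k - b| := by
  obtain ⟨Γ, hΓ⟩ : ∃ Γ, ∀ x ∈ Icc (-(5 * M)) (5 * M), |γ x| ≤ Γ :=
    isCompact_Icc.exists_bound_of_continuousOn hc.continuousOn
  have hΓ0 : 0 ≤ Γ := (abs_nonneg _).trans (hΓ 0 ⟨by linarith, by linarith⟩)
  refine ⟨2 * Γ, by positivity, fun a b k hb hk => ?_⟩
  have hmul : (γ a - γ b) * (k - b) ≤ |γ a - γ b| * |k - b| := by
    rw [← abs_mul]; exact le_abs_self _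
  have hmono := hγ.abs_sub_mul_abs_sub a b
  have h0 : 0 ≤ |γ a - γ b| * |a - b| := by positivity
  have h0' : 0 ≤ 2 * Γ * |k - b| := by positivity
  suffices |γ a - γ b| * |k - b| ≤ |γ a - γ b| * |a - b| / 2 + 2 * Γ * |k - b| by
    rw [hmono] at this
    nlinarith
  rcases le_total |a - b| (4 * M) with h | h
  · have hb' := abs_le.1 hb
    have hab := abs_le.1 h
    have h1 : |γ a - γ b| ≤ 2 * Γ := by
      have ha := hΓ a ⟨by linarith, by linarith⟩
      have hb'' := hΓ b ⟨by linarith, by linarith⟩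
      linarith [abs_sub (γ a) (γ b)]
    have := mul_le_mul_of_nonneg_right h1 (abs_nonneg (k - b))
    linarith
  · have h1 : |k - b| ≤ |a - b| / 2 := by linarith [abs_sub k b]
    have := mul_le_mul_of_nonneg_left h1 (abs_nonneg (γ a - γ b))
    linarith

lemma exists_abs_sub_le_add_mul {γ : ℝ → ℝ} (hc : Continuous γ) (hγ : Monotone γ) (M : ℝ) {ε : ℝ}
    (hε : 0 < ε) :
    ∃ A, 0 ≤ A ∧ ∀ a b, |b| ≤ M → |γ a - γ b| ≤ ε + A * ((γ a - γ b) * (a - b)) := by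
  have huc := isCompact_Icc.uniformContinuousOn_of_continuous
    (hc.continuousOn (s := Icc (-(M + 1)) (M + 1)))
  obtain ⟨δ₀, hδ₀, h⟩ := Metric.uniformContinuousOn_iff.1 huc ε hε
  set δ := min δ₀ 1
  have hδ : 0 < δ := lt_min hδ₀ one_pos
  refine ⟨1 / δ, by positivity, fun a b hb => ?_⟩
  rw [← hγ.abs_sub_mul_abs_sub a b]
  rcases lt_or_ge |a - b| δ with hab | hab
  · have hb' := abs_le.1 hb
    have hab' := abs_lt.1 (hab.trans_le (min_le_right _ _))
    have := h a ⟨by linarith, by linarith⟩ b ⟨by linarith, by linarith⟩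
      (hab.trans_le (min_le_left _ _))
    rw [Real.dist_eq] at this
    have h0 : 0 ≤ 1 / δ * (|γ a - γ b| * |a - b|) := by positivity
    linarith
  · have h1 : |γ a - γ b| * δ ≤ |γ a - γ b| * |a - b| :=
      mul_le_mul_of_nonneg_left hab (abs_nonneg _)
    rw [← le_div_iff₀ hδ] at h1
    rw [one_div_mul_eq_div]
    linarith

lemma exists_abs_sub_le_add_mul_abs {γ : ℝ → ℝ} (hc : Continuous γ) (M : ℝ) {ε : ℝ}
    (hε : 0 < ε) :
    ∃ A, 0 ≤ A ∧ ∀ a b, |a| ≤ M → |b| ≤ M → |γ a - γ b| ≤ ε + A * |a - b| := by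
  have huc := isCompact_Icc.uniformContinuousOn_of_continuous
    (hc.continuousOn (s := Icc (-M) M))
  obtain ⟨δ, hδ, h⟩ := Metric.uniformContinuousOn_iff.1 huc ε hε
  obtain ⟨Γ, hΓ⟩ : ∃ Γ, ∀ x ∈ Icc (-M) M, |γ x| ≤ Γ :=
    isCompact_Icc.exists_bound_of_continuousOn hc.continuousOn
  refine ⟨2 * |Γ| / δ, by positivity, fun a b ha hb => ?_⟩
  rcases lt_or_ge |a - b| δ with hab | hab
  · have := h a (abs_le.1 ha) b (abs_le.1 hb) hab
    rw [Real.dist_eq] at this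
    have h0 : 0 ≤ 2 * |Γ| / δ * |a - b| := by positivity
    linarith
  · have h1 : |γ a - γ b| ≤ 2 * |Γ| := by
      linarith [abs_sub (γ a) (γ b), hΓ a (abs_le.1 ha), hΓ b (abs_le.1 hb), le_abs_self Γ]
    have h2 : 2 * |Γ| ≤ 2 * |Γ| / δ * |a - b| := by
      rw [div_mul_eq_mul_div, le_div_iff₀ hδ]
      exact mul_le_mul_of_nonneg_left hab (by positivity)
    linarith

lemma StrictMono.exists_continuous_monotone_rightInverse {γ : ℝ → ℝ} (hγ : StrictMono γ)
    (hs : Function.Surjective γ) :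
    ∃ s : ℝ → ℝ, Continuous s ∧ Monotone s ∧ ∀ y, γ (s y) = y :=
  let e := hγ.orderIsoOfSurjective γ hs
  ⟨e.symm, e.symm.continuous, e.symm.monotone, fun y => e.apply_symm_apply y⟩

lemma neg_integral_rpow_le_integral_rho {ℓ p : ℝ} {a k : ℝ → ℝ} (hp : 1 < p)
    (hk : IntegrableOn (fun x => |k x| ^ p) (Ioo 0 ℓ)) :
    -∫ x in Ioo 0 ℓ, |k x| ^ p ≤ ∫ x in Ioo 0 ℓ, rho p (a x) * (a x - k x) := by
  by_cases hi : IntegrableOn (fun x => rho p (a x) * (a x - k x)) (Ioo 0 ℓ)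
  · rw [← integral_neg]
    exact integral_mono hk.neg hi fun x => neg_rpow_le_rho_mul_sub hp (a x) (k x)
  · rw [integral_undef hi, neg_nonpos]
    exact integral_nonneg fun x => by positivity

/-- Density of the domain on one edge. -/
lemma exists_intervalSobolev_comp_approx {ℓ p δ : ℝ} {γ g : ℝ → ℝ} (hℓ : 0 < ℓ) (hp : 1 < p)
    (hγc : Continuous γ) (hγ : StrictMono γ) (hγs : Function.Surjective γ)
    (hg : IntegrableOn g (Ioo 0 ℓ)) (hδ : 0 < δ) :
    ∃ u u' w : ℝ → ℝ, IntervalSobolev ℓ p u u' ∧ Continuous u ∧ u 0 = 0 ∧ u ℓ = 0 ∧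
      (∫ x in Ioo 0 ℓ, |γ (u x) - g x| < δ) ∧ Continuous w ∧
      ∀ φ φ', IntervalSobolev ℓ p φ φ' →
        ∫ x in Ioo 0 ℓ, rho p (u' x) * φ' x = ∫ x in Ioo 0 ℓ, w x * φ x := by
  obtain ⟨c, hcs, hcg, hc, hci⟩ :=
    hg.exists_hasCompactSupport_integral_sub_le (ε := δ / 4) (by positivity)
  obtain ⟨s, hsc, hsm, hs⟩ := hγ.exists_continuous_monotone_rightInverse hγs
  obtain ⟨K, hK⟩ := hcs.exists_bound_of_continuous hc
  set M := max |s (-K)| |s K|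
  have hbM : ∀ x, |s (c x)| ≤ M := fun x => by
    have := abs_le.1 (hK x)
    exact abs_le_max_abs_abs (hsm this.1) (hsm this.2)
  have hM0 : 0 ≤ M := (abs_nonneg _).trans (le_max_left _ _)
  obtain ⟨A, hA0, hA⟩ := exists_abs_sub_le_add_mul_abs hγc (M + 1) (ε := δ / (4 * ℓ))
    (by positivity)
  obtain ⟨u, u', w, hu, huc, hu0, huℓ, huM, hub, hw, hweak⟩ :=
    exists_intervalSobolev_approx (p := p) (ε := δ / (4 * (A + 1))) hℓ hp hM0
      (hsc.comp hc).aestronglyMeasurable (Eventually.of_forall hbM) (by positivity)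
  refine ⟨u, u', w, hu, huc, hu0, huℓ, ?_, hw, hweak⟩
  have hint : ∀ {f : ℝ → ℝ}, Continuous f → IntegrableOn f (Ioo 0 ℓ) := fun hf =>
    (hf.continuousOn.integrableOn_Icc).mono_set Ioo_subset_Icc_self
  have hd : Continuous fun x => |u x - s (c x)| := (huc.sub (hsc.comp hc)).abs
  have h1 : ∫ x in Ioo 0 ℓ, |γ (u x) - g x| ≤
      ∫ x in Ioo 0 ℓ, ((δ / (4 * ℓ) + A * |u x - s (c x)|) + ‖g x - c x‖) := by
    refine setIntegral_mono_on ((hint (hγc.comp huc)).sub hg).abs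
      ((hint (continuous_const.add (continuous_const.mul hd))).add (hg.sub hci).norm)
      measurableSet_Ioo fun x hx => ?_
    have h2 := hA (u x) (s (c x)) (huM x (Ioo_subset_Icc_self hx)) ((hbM x).trans (by linarith))
    rw [hs] at h2
    have h3 := abs_sub_le (γ (u x)) (c x) (g x)
    rw [Real.norm_eq_abs, abs_sub_comm (g x)]
    linarith
  have h2 := integral_add (μ := volume.restrict (Ioo 0 ℓ))
    (f := fun x => δ / (4 * ℓ) + A * |u x - s (c x)|) (g := fun x => ‖g x - c x‖)
    (hint (continuous_const.add (continuous_const.mul hd))) (hg.sub hci).norm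
  have h3 := integral_add (μ := volume.restrict (Ioo 0 ℓ))
    (f := fun _ => δ / (4 * ℓ)) (g := fun x => A * |u x - s (c x)|)
    (hint continuous_const) (hint (continuous_const.mul hd))
  have h4 : ∫ _ in Ioo 0 ℓ, δ / (4 * ℓ) = δ / 4 := by
    simp [hℓ.le]
    field_simp
  have h5 : A * ∫ x in Ioo 0 ℓ, |u x - s (c x)| ≤ δ / 4 := by
    calc A * ∫ x in Ioo 0 ℓ, |u x - s (c x)| ≤ A * (δ / (4 * (A + 1))) :=
          mul_le_mul_of_nonneg_left hub.le hA0
      _ ≤ (A + 1) * (δ / (4 * (A + 1))) := by gcongr; linarith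
      _ = δ / 4 := by field_simp
  rw [h4, integral_const_mul] at h3
  linarith

/-- The domain of the graph operator is dense in `L¹`. -/
lemma exists_isGraphWeakSolution_approx (G : MetricGraph) (p : G.E → ℝ) (hp : ∀ e, 1 < p e)
    (γ : G.E → ℝ → ℝ)
    (hγ : ∀ e, Continuous (γ e) ∧ StrictMono (γ e) ∧ Function.Surjective (γ e) ∧ γ e 0 = 0)
    (g : G.E → ℝ → ℝ) (hg : ∀ e, IntegrableOn (g e) (Ioo 0 (G.len e)) volume)
    {δ : ℝ} (hδ : 0 < δ) :
    ∃ w v : G.E → ℝ → ℝ,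
      (∀ e, IntegrableOn (w e) (Ioo 0 (G.len e)) volume) ∧
      IsGraphWeakSolution G p γ (fun e x => v e x + w e x) (fun _ => 0) v ∧
      edgeSum G (fun e => ∫ x in Ioo (0:ℝ) (G.len e), |v e x - g e x|) < δ := by
  let := G.fintypeE
  have hcard : (0:ℝ) < Fintype.card G.E + 1 := by positivity
  choose u u' w hu huc hu0 huℓ hug hw hweak using fun e =>
    exists_intervalSobolev_comp_approx (G.len_pos e) (hp e) (hγ e).1 (hγ e).2.1 (hγ e).2.2.1
      (hg e) (div_pos hδ hcard)
  have hint : ∀ e {f : ℝ → ℝ}, Continuous f → IntegrableOn f (Ioo 0 (G.len e)) := fun e f hf =>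
    (hf.continuousOn.integrableOn_Icc).mono_set Ioo_subset_Icc_self
  have hvi : ∀ e, IntegrableOn (fun x => γ e (u e x)) (Ioo 0 (G.len e)) := fun e =>
    hint e ((hγ e).1.comp (huc e))
  refine ⟨w, fun e x => γ e (u e x), fun e => hint e (hw e),
    ⟨u, u', fun _ => 0, hvi, ⟨hu, hu0, huℓ⟩, fun e => Eventually.of_forall fun x => rfl,
      fun φ φ' φV hφ => ?_⟩, ?_⟩
  · simp only [edgeSum, vertexSum, zero_mul, Finset.sum_const_zero, add_zero]
    rw [← Finset.sum_add_distrib]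
    refine Finset.sum_congr rfl fun e _ => ?_
    rw [hweak e _ _ (hφ.1 e), ← integral_add ((hφ.1 e).integrable_mul (G.len_pos e) (hvi e))
      ((hφ.1 e).integrable_mul (G.len_pos e) (hint e (hw e)))]
    simp only [add_mul]
  · calc edgeSum G (fun e => ∫ x in Ioo (0:ℝ) (G.len e), |γ e (u e x) - g e x|)
        ≤ ∑ _e : G.E, δ / (Fintype.card G.E + 1) := Finset.sum_le_sum fun e _ => (hug e).le
      _ = Fintype.card G.E * δ / (Fintype.card G.E + 1) := by
        rw [Finset.sum_const, Finset.card_univ, nsmul_eq_mul, mul_div_assoc]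
      _ < δ := by
        rw [div_lt_iff₀ hcard]
        linarith

/-- The resolvents of a bounded `g` converge to `g` in `L¹`. -/
lemma tendsto_resolvent (G : MetricGraph) (p : G.E → ℝ) (hp : ∀ e, 1 < p e)
    (γ : G.E → ℝ → ℝ)
    (hγ : ∀ e, Continuous (γ e) ∧ StrictMono (γ e) ∧ Function.Surjective (γ e) ∧ γ e 0 = 0)
    (g : G.E → ℝ → ℝ)
    (hg : ∀ e, IntegrableOn (g e) (Ioo 0 (G.len e)) volume)
    (hgbdd : ∀ e, ∃ K : ℝ, ∀ᵐ x ∂(volume.restrict (Ioo 0 (G.len e))), |g e x| ≤ K)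
    (vn : ℕ → G.E → ℝ → ℝ) (un un' : ℕ → G.E → ℝ → ℝ) (uVn : ℕ → G.V → ℝ)
    (hvn : ∀ n, ∀ e, IntegrableOn (vn n e) (Ioo 0 (G.len e)) volume)
    (hun : ∀ n, GraphSobolev G p (un n) (un' n) (uVn n))
    (hvu : ∀ n, ∀ e, ∀ᵐ x ∂(volume.restrict (Ioo 0 (G.len e))),
      vn n e x = γ e (un n e x))
    (hres : ∀ n, ∀ φ φ' : G.E → ℝ → ℝ, ∀ φV : G.V → ℝ, GraphSobolev G p φ φ' φV →
      edgeSum G (fun e => ∫ x in Ioo (0:ℝ) (G.len e), rho (p e) (un' n e x) * φ' e x)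
        = (n : ℝ) * edgeSum G (fun e => ∫ x in Ioo (0:ℝ) (G.len e),
            (g e x - vn n e x) * φ e x)) :
    Tendsto (fun n => edgeSum G (fun e =>
        ∫ x in Ioo (0:ℝ) (G.len e), |vn n e x - g e x|)) atTop (nhds 0) := by
  let := G.fintypeE
  choose K hK using hgbdd
  choose s hsc hsm hs using fun e =>
    (hγ e).2.1.exists_continuous_monotone_rightInverse (hγ e).2.2.1
  set b : G.E → ℝ → ℝ := fun e x => s e (g e x)
  set M : G.E → ℝ := fun e => max |s e (-K e)| |s e (K e)|
  have hM0 : ∀ e, 0 ≤ M e := fun e => (abs_nonneg _).trans (le_max_left _ _)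
  have hbM : ∀ e, ∀ᵐ x ∂(volume.restrict (Ioo 0 (G.len e))), |b e x| ≤ M e := fun e => by
    filter_upwards [hK e] with x hx
    exact abs_le_max_abs_abs (hsm e (abs_le.1 hx).1) (hsm e (abs_le.1 hx).2)
  have hbm : ∀ e, AEStronglyMeasurable (b e) (volume.restrict (Ioo 0 (G.len e))) := fun e =>
    (hsc e).comp_aestronglyMeasurable (hg e).1
  have hbi : ∀ e, IntegrableOn (b e) (Ioo 0 (G.len e)) := fun e =>
    Integrable.of_bound (hbm e) (M e) (by simpa only [Real.norm_eq_abs] using hbM e)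
  have hdi : ∀ n e, IntegrableOn (fun x => vn n e x - g e x) (Ioo 0 (G.len e)) := fun n e =>
    (hvn n e).sub (hg e)
  have hmono : ∀ e, Monotone (γ e) := fun e => (hγ e).2.1.monotone
  set J : ℕ → G.E → ℝ := fun n e =>
    ∫ x in Ioo 0 (G.len e), (vn n e x - g e x) * (un n e x - b e x)
  have hJi : ∀ n e, IntegrableOn (fun x => (vn n e x - g e x) * (un n e x - b e x))
      (Ioo 0 (G.len e)) := fun n e => by
    simp only [mul_sub]
    exact (((hun n).1 e).integrable_mul (G.len_pos e) (hdi n e)).sub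
      ((hdi n e).mul_bdd (hbm e) (by simpa only [Real.norm_eq_abs] using hbM e))
  have hJ0 : ∀ n e, 0 ≤ J n e := fun n e => by
    refine integral_nonneg_of_ae ?_
    filter_upwards [hvu n e] with x hx
    have : g e x = γ e (b e x) := (hs e _).symm
    rw [hx, this, ← (hmono e).abs_sub_mul_abs_sub]
    exact mul_nonneg (abs_nonneg _) (abs_nonneg _)
  have hJsum : Tendsto (fun n => ∑ e, J n e) atTop (nhds 0) := by
    refine Metric.tendsto_atTop.2 fun ε hε => ?_
    choose D hD0 hD using fun e => exists_half_mul_sub_le (hγ e).1 (hmono e)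
      (by linarith [hM0 e] : 0 ≤ M e + 1)
    have hcard : (0:ℝ) < Fintype.card G.E + 1 := by positivity
    choose k k' w hk hkc hk0 hkℓ hkM hkb _hw _hweak using fun e =>
      exists_intervalSobolev_approx (ε := ε / (4 * (Fintype.card G.E + 1) * (D e + 1)))
        (G.len_pos e) (hp e) (hM0 e) (hbm e) (hbM e) (by have := hD0 e; positivity)
    set C : ℝ := ∑ e, ∫ x in Ioo 0 (G.len e), |k' e x| ^ p e with hC
    have henergy : ∀ n : ℕ, n * ∑ e, ∫ x in Ioo 0 (G.len e),
        (vn n e x - g e x) * (un n e x - k e x) ≤ C := fun n => by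
      have h1 := hres n (fun e x => un n e x - k e x) (fun e x => un' n e x - k' e x) (uVn n)
        ⟨fun e => ((hun n).1 e).sub (G.len_pos e) (hp e) (hk e),
          fun e => by simp only [hk0, sub_zero, (hun n).2.1],
          fun e => by simp only [hkℓ, sub_zero, (hun n).2.2]⟩
      simp only [edgeSum] at h1
      have h2 : -C ≤ ∑ e, ∫ x in Ioo (0:ℝ) (G.len e),
          rho (p e) (un' n e x) * (un' n e x - k' e x) := by
        rw [hC, ← Finset.sum_neg_distrib]
        exact Finset.sum_le_sum fun e _ => neg_integral_rpow_le_integral_rho (hp e) (hk e).2.1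
      have h3 : ∑ e, ∫ x in Ioo (0:ℝ) (G.len e), (g e x - vn n e x) * (un n e x - k e x) =
          -∑ e, ∫ x in Ioo 0 (G.len e), (vn n e x - g e x) * (un n e x - k e x) := by
        rw [← Finset.sum_neg_distrib]
        refine Finset.sum_congr rfl fun e _ => ?_
        rw [← integral_neg]
        congr 1 with x
        ring
      rw [h1, h3] at h2
      linarith
    have hhalf : ∀ n e, J n e / 2 ≤ (∫ x in Ioo 0 (G.len e),
        (vn n e x - g e x) * (un n e x - k e x)) + ε / (4 * (Fintype.card G.E + 1)) :=
      fun n e => by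
      have hkbi : IntegrableOn (fun x => |k e x - b e x|) (Ioo 0 (G.len e)) :=
        (((hkc e).continuousOn.integrableOn_Icc.mono_set Ioo_subset_Icc_self).sub (hbi e)).abs
      have hi : IntegrableOn (fun x => (vn n e x - g e x) * (un n e x - k e x))
          (Ioo 0 (G.len e)) :=
        (((hun n).1 e).sub (G.len_pos e) (hp e) (hk e)).integrable_mul (G.len_pos e) (hdi n e)
      have h1 : ∫ x in Ioo 0 (G.len e), (vn n e x - g e x) * (un n e x - b e x) / 2 ≤
          ∫ x in Ioo 0 (G.len e),
            ((vn n e x - g e x) * (un n e x - k e x) + D e * |k e x - b e x|) := by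
        refine integral_mono_ae ((hJi n e).div_const 2) (hi.add (hkbi.const_mul _)) ?_
        filter_upwards [hvu n e, hbM e, ae_restrict_mem measurableSet_Ioo] with x hx hbx hxm
        have h2 := hD e (un n e x) (b e x) (k e x) (by linarith)
          (hkM e x (Ioo_subset_Icc_self hxm))
        have h3 : γ e (b e x) = g e x := hs e _
        rwa [h3, ← hx] at h2
      rw [integral_div, integral_add hi (hkbi.const_mul _), integral_const_mul] at h1
      refine h1.trans (add_le_add_right ?_ _)
      have hD1 : 0 < D e + 1 := by linarith [hD0 e]
      calc D e * ∫ x in Ioo 0 (G.len e), |k e x - b e x|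
          ≤ (D e + 1) * (ε / (4 * (Fintype.card G.E + 1) * (D e + 1))) :=
            mul_le_mul (by linarith) (hkb e).le (integral_nonneg fun _ => abs_nonneg _) hD1.le
        _ = ε / (4 * (Fintype.card G.E + 1)) := by field_simp
    have hsum : ∀ n, (∑ e, J n e) / 2 ≤ (∑ e, ∫ x in Ioo 0 (G.len e),
        (vn n e x - g e x) * (un n e x - k e x)) + ε / 4 := fun n => by
      rw [Finset.sum_div]
      refine (Finset.sum_le_sum fun e _ => hhalf n e).trans ?_
      rw [Finset.sum_add_distrib, Finset.sum_const, Finset.card_univ, nsmul_eq_mul]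
      refine add_le_add_right ?_ _
      calc (Fintype.card G.E : ℝ) * (ε / (4 * (Fintype.card G.E + 1)))
          ≤ (Fintype.card G.E + 1) * (ε / (4 * (Fintype.card G.E + 1))) := by
            gcongr; linarith
        _ = ε / 4 := by field_simp
    obtain ⟨N, hN⟩ := exists_nat_gt (4 * |C| / ε)
    refine ⟨N, fun n hn => ?_⟩
    have hn' : 4 * |C| / ε < n := hN.trans_le (by exact_mod_cast hn)
    have hn0 : (0:ℝ) < n := lt_of_le_of_lt (by positivity) hn'
    rw [div_lt_iff₀ hε] at hn'
    have h1 : ∑ e, ∫ x in Ioo 0 (G.len e), (vn n e x - g e x) * (un n e x - k e x) < ε / 4 := by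
      refine lt_of_mul_lt_mul_left ?_ hn0.le
      linarith [henergy n, le_abs_self C]
    rw [Real.dist_eq, sub_zero, abs_of_nonneg (Finset.sum_nonneg fun e _ => hJ0 n e)]
    linarith [hsum n]
  have hJe : ∀ e, Tendsto (fun n => J n e) atTop (nhds 0) := fun e =>
    squeeze_zero (fun n => hJ0 n e)
      (fun n => Finset.single_le_sum (fun e _ => hJ0 n e) (Finset.mem_univ e)) hJsum
  have hedge : ∀ e, Tendsto (fun n => ∫ x in Ioo (0:ℝ) (G.len e), |vn n e x - g e x|) atTop
      (nhds 0) := fun e => by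
    have hℓ := G.len_pos e
    refine Metric.tendsto_atTop'.2 fun ε hε => ?_
    obtain ⟨A, hA0, hA⟩ := exists_abs_sub_le_add_mul (hγ e).1 (hmono e) (M e)
      (ε := ε / (2 * G.len e)) (by positivity)
    have hbound : ∀ n, ∫ x in Ioo (0:ℝ) (G.len e), |vn n e x - g e x| ≤ ε / 2 + A * J n e :=
      fun n => by
      have h1 : ∫ x in Ioo (0:ℝ) (G.len e), |vn n e x - g e x| ≤
          ∫ x in Ioo (0:ℝ) (G.len e), (ε / (2 * G.len e) +
            A * ((vn n e x - g e x) * (un n e x - b e x))) := by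
        refine integral_mono_ae (hdi n e).abs
          ((integrable_const _).add ((hJi n e).const_mul A)) ?_
        filter_upwards [hvu n e, hbM e] with x hx hbx
        have h2 := hA (un n e x) (b e x) hbx
        have h3 : γ e (b e x) = g e x := hs e _
        rwa [h3, ← hx] at h2
      rw [integral_add (integrable_const _) ((hJi n e).const_mul A), integral_const_mul] at h1
      have h4 : ∫ _ in Ioo 0 (G.len e), ε / (2 * G.len e) = ε / 2 := by
        simp [hℓ.le]
        field_simp
      rwa [h4] at h1
    have hlim : Tendsto (fun n => ε / 2 + A * J n e) atTop (nhds (ε / 2 + A * 0)) :=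
      ((hJe e).const_mul A).const_add _
    obtain ⟨N, hN⟩ := eventually_atTop.1
      (hlim.eventually_lt_const (by linarith : ε / 2 + A * 0 < ε))
    refine ⟨N, fun n hn => ?_⟩
    rw [Real.dist_eq, sub_zero, abs_of_nonneg (integral_nonneg fun _ => abs_nonneg _)]
    exact (hbound n).trans_lt (hN n hn.le)
  simp only [edgeSum]
  simpa using tendsto_finsetSum (Finset.univ : Finset G.E) fun e _ => hedge e

/-- Theorem 3.13, density of the domain: the resolvents
vⁿ = (I + (1/n)𝒜)⁻¹ g of a bounded g converge to g in L¹(G), and consequently the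
domain of the operator is dense in L¹(G). -/
theorem graph_operator_domain_dense
    (G : MetricGraph) (p : G.E → ℝ) (hp : ∀ e, 1 < p e)
    (γ : G.E → ℝ → ℝ)
    (hγ : ∀ e, Continuous (γ e) ∧ StrictMono (γ e) ∧ Function.Surjective (γ e) ∧ γ e 0 = 0)
    (g : G.E → ℝ → ℝ)
    (hg : ∀ e, IntegrableOn (g e) (Ioo 0 (G.len e)) volume)
    (hgbdd : ∀ e, ∃ K : ℝ, ∀ᵐ x ∂(volume.restrict (Ioo 0 (G.len e))), |g e x| ≤ K)
    (vn : ℕ → G.E → ℝ → ℝ) (un un' : ℕ → G.E → ℝ → ℝ) (uVn : ℕ → G.V → ℝ)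
    (hvn : ∀ n, ∀ e, IntegrableOn (vn n e) (Ioo 0 (G.len e)) volume)
    (hun : ∀ n, GraphSobolev G p (un n) (un' n) (uVn n))
    (hvu : ∀ n, ∀ e, ∀ᵐ x ∂(volume.restrict (Ioo 0 (G.len e))),
      vn n e x = γ e (un n e x))
    (hres : ∀ n, ∀ φ φ' : G.E → ℝ → ℝ, ∀ φV : G.V → ℝ, GraphSobolev G p φ φ' φV →
      edgeSum G (fun e => ∫ x in Ioo (0:ℝ) (G.len e), rho (p e) (un' n e x) * φ' e x)
        = (n : ℝ) * edgeSum G (fun e => ∫ x in Ioo (0:ℝ) (G.len e),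
            (g e x - vn n e x) * φ e x)) :
    Tendsto (fun n => edgeSum G (fun e =>
        ∫ x in Ioo (0:ℝ) (G.len e), |vn n e x - g e x|)) atTop (nhds 0) ∧
    (∀ g₂ : G.E → ℝ → ℝ, (∀ e, IntegrableOn (g₂ e) (Ioo 0 (G.len e)) volume) →
      ∀ δ : ℝ, 0 < δ →
        ∃ w v : G.E → ℝ → ℝ,
          (∀ e, IntegrableOn (w e) (Ioo 0 (G.len e)) volume) ∧
          IsGraphWeakSolution G p γ (fun e x => v e x + w e x) (fun _ => 0) v ∧
          edgeSum G (fun e => ∫ x in Ioo (0:ℝ) (G.len e), |v e x - g₂ e x|) < δ) := by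
  exact ⟨tendsto_resolvent G p hp γ hγ g hg hgbdd vn un un' uVn hvn hun hvu hres,
    fun g₂ hg₂ δ hδ => exists_isGraphWeakSolution_approx G p hp γ hγ g₂ hg₂ hδ⟩
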